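/- Let H be an r-uniform hypergraph (r ≥ 3) that contains no Berge path of length r+1 and no Berge cycle of length r+1. If H contains a Berge cycle of length r, then there exist r+1 vertices of H and r hyperedges of H such that every hyperedge of H containing any of these r+1 vertices is among these r hyperedges. -/

import Mathlib

/-- A Berge path of length `k` in a hypergraph with hyperedge set `E`. -/
def IsBergePath {V : Type*} (E : Finset (Finset V)) (k : ℕ)
    (v : Fin (k + 1) → V) (h : Fin k → Finset V) : Prop :=
  Function.Injective v ∧ Function.Injective h ∧ (∀ i, h i ∈ E) ∧
    ∀ i : Fin k, v i.castSucc ∈ h i ∧ v i.succ ∈ h i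

def HasBergePath {V : Type*} (E : Finset (Finset V)) (k : ℕ) : Prop :=
  ∃ v h, IsBergePath E k v h

/-- A Berge cycle of length `k`. -/
def IsBergeCycle {V : Type*} (E : Finset (Finset V)) (k : ℕ)
    (v : Fin k → V) (h : Fin k → Finset V) : Prop :=
  Function.Injective v ∧ Function.Injective h ∧ (∀ i, h i ∈ E) ∧
    ∀ i : Fin k, v i ∈ h i ∧ v ⟨((i : ℕ) + 1) % k, Nat.mod_lt _ i.pos⟩ ∈ h i

def HasBergeCycle {V : Type*} (E : Finset (Finset V)) (k : ℕ) : Prop :=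
  ∃ v h, IsBergeCycle E k v h

theorem isBergeCycle_succ_iff {V : Type*} {E : Finset (Finset V)} {n : ℕ}
    {v : Fin (n + 1) → V} {h : Fin (n + 1) → Finset V} :
    IsBergeCycle E (n + 1) v h ↔ Function.Injective v ∧ Function.Injective h ∧
      (∀ i, h i ∈ E) ∧ ∀ i, v i ∈ h i ∧ v (i + 1) ∈ h i := by
  have key (i : Fin (n + 1)) :
      (⟨((i : ℕ) + 1) % (n + 1), Nat.mod_lt _ i.pos⟩ : Fin (n + 1)) = i + 1 := by
    ext
    simp [Fin.val_add]
  simp only [IsBergeCycle, key]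

namespace IsBergeCycle

variable {V : Type*} {E : Finset (Finset V)} {n : ℕ}
  {v : Fin (n + 1) → V} {h : Fin (n + 1) → Finset V}

theorem rotate (hc : IsBergeCycle E (n + 1) v h) (s : Fin (n + 1)) :
    IsBergeCycle E (n + 1) (fun i => v (i + s)) (fun i => h (i + s)) := by
  rw [isBergeCycle_succ_iff] at hc ⊢
  obtain ⟨hv, hh, hE, hm⟩ := hc
  refine ⟨fun a b hab => add_right_cancel (hv hab), fun a b hab => add_right_cancel (hh hab),
    fun i => hE _, fun i => ⟨(hm _).1, ?_⟩⟩
  rw [add_right_comm]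
  exact (hm _).2

theorem reverse (hc : IsBergeCycle E (n + 1) v h) :
    IsBergeCycle E (n + 1) (fun i => v (-i)) (fun i => h (-i - 1)) := by
  rw [isBergeCycle_succ_iff] at hc ⊢
  obtain ⟨hv, hh, hE, hm⟩ := hc
  refine ⟨fun a b hab => neg_injective (hv hab),
    fun a b hab => neg_injective (sub_left_injective (hh hab)), fun i => hE _, fun i => ⟨?_, ?_⟩⟩
  · simpa using (hm (-i - 1)).2
  · rw [neg_add, ← sub_eq_add_neg]
    exact (hm _).1

theorem update (hc : IsBergeCycle E (n + 1) v h) (i : Fin (n + 1)) {e : Finset V} (he : e ∈ E)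
    (hne : e ∉ Set.range h) (h0 : v i ∈ e) (h1 : v (i + 1) ∈ e) :
    IsBergeCycle E (n + 1) v (Function.update h i e) := by
  rw [isBergeCycle_succ_iff] at hc ⊢
  obtain ⟨hv, hh, hE, hm⟩ := hc
  refine ⟨hv, fun a b hab => ?_, fun j => ?_, fun j => ?_⟩
  · by_cases ha : a = i <;> by_cases hb : b = i
    · rw [ha, hb]
    · subst ha
      simp only [Function.update_self, Function.update_of_ne hb] at hab
      exact absurd ⟨b, hab.symm⟩ hne
    · subst hb
      simp only [Function.update_self, Function.update_of_ne ha] at hab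
      exact absurd ⟨a, hab⟩ hne
    · simp only [Function.update_of_ne ha, Function.update_of_ne hb] at hab
      exact hh hab
  · by_cases hj : j = i
    · simpa [hj] using he
    · simpa [hj] using hE j
  · by_cases hj : j = i
    · subst hj
      simpa using ⟨h0, h1⟩
    · simpa [hj] using hm j

/-- The vertices of a Berge cycle followed by a further vertex of the last hyperedge
form a Berge path. -/
theorem isBergePath_snoc (hc : IsBergeCycle E (n + 1) v h) {w : V} (hw : w ∈ h (Fin.last n))
    (hwv : w ∉ Set.range v) :
    IsBergePath E (n + 1) (Fin.snoc v w : Fin (n + 2) → V) h := by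
  rw [isBergeCycle_succ_iff] at hc
  obtain ⟨hv, hh, hE, hm⟩ := hc
  refine ⟨Fin.snoc_injective_iff.2 ⟨hv, hwv⟩, hh, hE, fun j => ⟨?_, ?_⟩⟩
  · simpa using (hm j).1
  · induction j using Fin.lastCases with
    | last => simpa [Fin.succ_last] using hw
    | cast k =>
      rw [Fin.succ_castSucc, Fin.snoc_castSucc]
      simpa [Fin.coeSucc_eq_succ] using (hm k.castSucc).2

end IsBergeCycle

theorem IsBergePath.cons {V : Type*} {E : Finset (Finset V)} {k : ℕ} {v : Fin (k + 1) → V}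
    {h : Fin k → Finset V} (hp : IsBergePath E k v h) {u : V} {e : Finset V} (he : e ∈ E)
    (hne : e ∉ Set.range h) (hue : u ∈ e) (hu : u ∉ Set.range v) (h0 : v 0 ∈ e) :
    IsBergePath E (k + 1) (Fin.cons u v : Fin (k + 2) → V)
      (Fin.cons e h : Fin (k + 1) → Finset V) := by
  obtain ⟨hv, hh, hE, hm⟩ := hp
  refine ⟨Fin.cons_injective_iff.2 ⟨hu, hv⟩, Fin.cons_injective_iff.2 ⟨hne, hh⟩,
    fun j => ?_, fun j => ?_⟩
  · induction j using Fin.cases with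
    | zero => simpa using he
    | succ j => simpa using hE j
  · induction j using Fin.cases with
    | zero => simpa using ⟨hue, h0⟩
    | succ j => simpa [← Fin.succ_castSucc] using hm j

theorem IsBergePath.snoc {V : Type*} {E : Finset (Finset V)} {k : ℕ} {v : Fin (k + 1) → V}
    {h : Fin k → Finset V} (hp : IsBergePath E k v h) {u : V} {e : Finset V} (he : e ∈ E)
    (hne : e ∉ Set.range h) (hue : u ∈ e) (hu : u ∉ Set.range v) (hl : v (Fin.last k) ∈ e) :
    IsBergePath E (k + 1) (Fin.snoc v u : Fin (k + 2) → V)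
      (Fin.snoc h e : Fin (k + 1) → Finset V) := by
  obtain ⟨hv, hh, hE, hm⟩ := hp
  refine ⟨Fin.snoc_injective_iff.2 ⟨hv, hu⟩, Fin.snoc_injective_iff.2 ⟨hh, hne⟩,
    fun j => ?_, fun j => ?_⟩
  · induction j using Fin.lastCases with
    | last => simpa using he
    | cast j => simpa using hE j
  · induction j using Fin.lastCases with
    | last => simpa [Fin.succ_last] using ⟨hl, hue⟩
    | cast j =>
      rw [Fin.succ_castSucc]
      simpa only [Fin.snoc_castSucc] using hm j

namespace IsBergeCycle

variable {V : Type*} {E : Finset (Finset V)} {n : ℕ}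
  {v : Fin (n + 1) → V} {h : Fin (n + 1) → Finset V}

/-- Inserting a vertex and a hyperedge between the last and the first vertex of a Berge cycle. -/
theorem cons (hc : IsBergeCycle E (n + 1) v h) {u : V} {e : Finset V} (he : e ∈ E)
    (hne : e ∉ Set.range h) (hue : u ∈ e) (hu : u ∉ Set.range v) (h0 : v 0 ∈ e)
    (hul : u ∈ h (Fin.last n)) :
    IsBergeCycle E (n + 2) (Fin.cons u v : Fin (n + 2) → V)
      (Fin.cons e h : Fin (n + 2) → Finset V) := by
  rw [isBergeCycle_succ_iff] at hc ⊢
  obtain ⟨hv, hh, hE, hm⟩ := hc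
  refine ⟨Fin.cons_injective_iff.2 ⟨hu, hv⟩, Fin.cons_injective_iff.2 ⟨hne, hh⟩,
    fun j => ?_, fun j => ?_⟩
  · induction j using Fin.cases with
    | zero => simpa using he
    | succ j => simpa using hE j
  · induction j using Fin.cases with
    | zero =>
      rw [zero_add, ← Fin.succ_zero_eq_one]
      simpa only [Fin.cons_zero, Fin.cons_succ] using ⟨hue, h0⟩
    | succ j =>
      refine ⟨by simpa using (hm j).1, ?_⟩
      induction j using Fin.lastCases with
      | last => simpa [Fin.succ_last, Fin.last_add_one] using hul
      | cast k =>
        have := (hm k.castSucc).2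
        rw [Fin.coeSucc_eq_succ] at this
        rw [Fin.succ_castSucc, Fin.coeSucc_eq_succ]
        simpa only [Fin.cons_succ, ← Fin.succ_castSucc] using this

/-- If neither a longer Berge path nor a longer Berge cycle exists, and a hyperedge off the cycle
joins the first cycle vertex to a vertex off the cycle, then the last cycle hyperedge lies
inside the vertex set of the cycle. -/
theorem last_subset (hc : IsBergeCycle E (n + 1) v h) (hnp : ¬ HasBergePath E (n + 2))
    (hnc : ¬ HasBergeCycle E (n + 2)) {u : V} {e : Finset V} (he : e ∈ E)
    (hne : e ∉ Set.range h) (hue : u ∈ e) (hu : u ∉ Set.range v) (h0 : v 0 ∈ e) :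
    ∀ w ∈ h (Fin.last n), w ∈ Set.range v := by
  intro w hw
  by_contra hwv
  by_cases hwu : w = u
  · subst hwu
    exact hnc ⟨_, _, hc.cons he hne hue hu h0 hw⟩
  · refine hnp ⟨_, _, (hc.isBergePath_snoc hw hwv).cons he hne hue ?_ ?_⟩
    · rintro ⟨j, hj⟩
      induction j using Fin.lastCases with
      | last => exact hwu (by simpa using hj)
      | cast j => exact hu ⟨j, by simpa using hj⟩
    · rw [← Fin.castSucc_zero, Fin.snoc_castSucc]
      exact h0

theorem eq_univ_map (hc : IsBergeCycle E (n + 1) v h) {e : Finset V} (hcard : e.card = n + 1)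
    (hsub : ∀ w ∈ e, w ∈ Set.range v) : e = Finset.univ.map ⟨v, hc.1⟩ := by
  refine Finset.eq_of_subset_of_card_le (fun w hw => ?_) (by simp [hcard])
  simpa using hsub w hw

/-- A hyperedge off the cycle that meets the cycle lies inside its vertex set. -/
theorem subset_of_mem (hc : IsBergeCycle E (n + 1) v h) (hn : 1 ≤ n)
    (hunif : ∀ e ∈ E, e.card = n + 1) (hnp : ¬ HasBergePath E (n + 2))
    (hnc : ¬ HasBergeCycle E (n + 2)) {e : Finset V} (he : e ∈ E)
    (hne : e ∉ Set.range h) (i : Fin (n + 1)) (hi : v i ∈ e) :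
    ∀ u ∈ e, u ∈ Set.range v := by
  intro u hue
  by_contra hu
  have h1 := (hc.rotate i).last_subset hnp hnc he (by rintro ⟨j, hj⟩; exact hne ⟨_, hj⟩) hue
    (by rintro ⟨j, hj⟩; exact hu ⟨_, hj⟩) (by simpa using hi)
  have h2 := (hc.rotate i).reverse.last_subset hnp hnc he
    (by rintro ⟨j, hj⟩; exact hne ⟨_, hj⟩) hue
    (by rintro ⟨j, hj⟩; exact hu ⟨_, hj⟩) (by simpa using hi)
  have e1 := hc.eq_univ_map (hunif _ (hc.2.2.1 _)) fun w hw => by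
    obtain ⟨j, hj⟩ := h1 w hw
    exact ⟨_, hj⟩
  have e2 := hc.eq_univ_map (hunif _ (hc.2.2.1 _)) fun w hw => by
    obtain ⟨j, hj⟩ := h2 w hw
    exact ⟨_, hj⟩
  have h3 := add_right_cancel (hc.2.1 (e1.trans e2.symm))
  have h4 : Fin.last n + 1 = 0 := Fin.last_add_one n
  have h5 : -Fin.last n - 1 = 0 := by rw [← neg_add', h4, neg_zero]
  rw [h5] at h3
  have := congrArg Fin.val h3
  simp at this
  omega

/-- Every hyperedge meeting the cycle is a hyperedge of the cycle. -/
theorem mem_range_of_mem (hc : IsBergeCycle E (n + 1) v h) (hn : 1 ≤ n)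
    (hunif : ∀ e ∈ E, e.card = n + 1) (hnp : ¬ HasBergePath E (n + 2))
    (hnc : ¬ HasBergeCycle E (n + 2)) {e : Finset V} (he : e ∈ E)
    (i : Fin (n + 1)) (hi : v i ∈ e) : e ∈ Set.range h := by
  by_contra hne
  have heq := hc.eq_univ_map (hunif e he) (hc.subset_of_mem hn hunif hnp hnc he hne i hi)
  have hmem (j) : v j ∈ e := by simp [heq]
  have hc' := hc.update 0 he hne (hmem _) (hmem _)
  have hsub := hc'.subset_of_mem hn hunif hnp hnc (hc.2.2.1 0) (by
    rintro ⟨j, hj⟩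
    by_cases hj0 : j = 0
    · subst hj0
      rw [Function.update_self] at hj
      exact hne ⟨0, hj.symm⟩
    · rw [Function.update_of_ne hj0] at hj
      exact hj0 (hc.2.1 hj)) 0 (hc.2.2.2 0).1
  exact hne ⟨0, (hc.eq_univ_map (hunif _ (hc.2.2.1 0)) hsub).trans heq.symm⟩

theorem exists_notMem_range (hc : IsBergeCycle E (n + 1) v h) (hn : 1 ≤ n)
    (hunif : ∀ e ∈ E, e.card = n + 1) : ∃ i, ∃ u ∈ h i, u ∉ Set.range v := by
  by_contra! hall
  have key (i) := hc.eq_univ_map (hunif _ (hc.2.2.1 i)) (hall i)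
  have := congrArg Fin.val (hc.2.1 ((key 0).trans (key (Fin.last n)).symm))
  simp at this
  omega

end IsBergeCycle

/-- If an `r`-uniform hypergraph with no Berge path of length `r+1` and no Berge
cycle of length `r+1` contains a Berge cycle of length `r`, then there are `r+1`
vertices and `r` hyperedges such that every hyperedge containing any of these
vertices is among these `r` hyperedges. -/
theorem cycle_gives_confined_vertices {V : Type*} [DecidableEq V] (r : ℕ) (hr : 3 ≤ r)
    (E : Finset (Finset V)) (hunif : ∀ e ∈ E, e.card = r)
    (hnp : ¬ HasBergePath E (r + 1)) (hnc : ¬ HasBergeCycle E (r + 1))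
    (hcy : HasBergeCycle E r) :
    ∃ (S : Finset V) (T : Finset (Finset V)), S.card = r + 1 ∧ T ⊆ E ∧ T.card = r ∧
      ∀ e ∈ E, (∃ x ∈ S, x ∈ e) → e ∈ T := by
  obtain ⟨v, h, hc⟩ := hcy
  obtain ⟨n, rfl⟩ : ∃ n, r = n + 1 := ⟨r - 1, by omega⟩
  have hn : 1 ≤ n := by omega
  obtain ⟨i, u, hui, hu⟩ := hc.exists_notMem_range hn hunif
  refine ⟨insert u (Finset.univ.map ⟨v, hc.1⟩), Finset.univ.map ⟨h, hc.2.1⟩, ?_, ?_, by simp, ?_⟩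
  · rw [Finset.card_insert_of_notMem (by simpa using hu)]
    simp
  · intro e he
    obtain ⟨j, rfl⟩ : ∃ j, h j = e := by simpa using he
    exact hc.2.2.1 j
  · rintro e he ⟨x, hxS, hxe⟩
    suffices e ∈ Set.range h by simpa using this
    have hmem := hc.mem_range_of_mem hn hunif hnp hnc he
    obtain rfl | ⟨j, rfl⟩ : x = u ∨ ∃ j, v j = x := by simpa using hxS
    · by_contra hne
      obtain ⟨w, hwe, hwx⟩ := Finset.exists_mem_ne (by rw [hunif e he]; omega) x
      have hwv : w ∉ Set.range v := by
        rintro ⟨j, rfl⟩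
        exact hne (hmem j hwe)
      have hp := (hc.rotate (i + 1)).isBergePath_snoc (w := x)
        (by rwa [add_comm i 1, ← add_assoc, Fin.last_add_one, zero_add])
        (by rintro ⟨j, hj⟩; exact hu ⟨_, hj⟩)
      refine hnp ⟨_, _, hp.snoc he (by rintro ⟨j, hj⟩; exact hne ⟨_, hj⟩) hwe ?_ (by simpa)⟩
      rintro ⟨j, hj⟩
      induction j using Fin.lastCases with
      | last => exact hwx (by simpa using hj.symm)
      | cast j => exact hwv ⟨j + (i + 1), by simpa using hj⟩
    · exact hmem j hxe
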